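/- arXiv:2011.11747 — 15 statements merged into one kernel-verified Lean document; each statement's English description precedes it below -/
import Mathlib

section
/- Let M be a finite monoid and let e, f ∈ M be idempotents. Then there exist a, b ∈ M with a*b = e and b*a = f if and only if MeM = MfM, where MeM = {m*e*n | m, n ∈ M}. -/
/-- In a finite monoid, an idempotent `g` below an idempotent `f` with `f ∈ MgM` equals `f`. -/
theorem eq_of_idempotent_of_eq_mul_mul {M : Type*} [Monoid M] [Finite M] {f g x y : M}
    (hf : f * f = f) (hg : g * g = g) (hfg : f * g = g) (hgf : g * f = g)
    (h : f = x * g * y) : g = f := by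
  let φ : {z : M // f * z = z} → {z : M // f * z = z} :=
    fun z => ⟨g * y * z, by rw [← mul_assoc, ← mul_assoc, hfg]⟩
  have hφ (z : {z : M // f * z = z}) : x * (φ z : M) = z := by
    change x * (g * y * z) = z
    rw [← mul_assoc, ← mul_assoc, ← h, z.2]
  have hinj : Function.Injective φ := fun z w hzw => Subtype.ext <| by
    rw [← hφ z, ← hφ w, hzw]
  obtain ⟨w, hw⟩ := Finite.surjective_of_injective hinj ⟨f, hf⟩
  have hw' : g * y * w = f := congrArg Subtype.val hw
  rw [← hgf, ← hw', ← mul_assoc, ← mul_assoc, hg]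

/-- For idempotents `e, f` of a finite monoid `M`, there exist `a, b ∈ M` with
`a*b = e` and `b*a = f` if and only if `MeM = MfM`. -/
theorem stmt_1 {M : Type*} [Monoid M] [Finite M] (e f : M) (he : e * e = e) (hf : f * f = f) :
    (∃ a b : M, a * b = e ∧ b * a = f) ↔
      {z : M | ∃ m n : M, z = m * e * n} = {z : M | ∃ m n : M, z = m * f * n} := by
  constructor
  · rintro ⟨a, b, hab, hba⟩
    have h₁ : e = a * f * b := by
      rw [← he, ← hab, ← hba]; simp only [mul_assoc]
    have h₂ : f = b * e * a := by
      rw [← hf, ← hab, ← hba]; simp only [mul_assoc]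
    ext z
    constructor
    · rintro ⟨m, n, rfl⟩
      exact ⟨m * a, b * n, by rw [h₁]; simp only [mul_assoc]⟩
    · rintro ⟨m, n, rfl⟩
      exact ⟨m * b, a * n, by rw [h₂]; simp only [mul_assoc]⟩
  · intro h
    obtain ⟨p, q, hpq⟩ : e ∈ {z : M | ∃ m n : M, z = m * f * n} := h ▸ ⟨1, 1, by simp⟩
    obtain ⟨r, s, hrs⟩ : f ∈ {z : M | ∃ m n : M, z = m * e * n} := h ▸ ⟨1, 1, by simp⟩
    obtain ⟨a, ha⟩ : ∃ a, a = e * p * f := ⟨_, rfl⟩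
    obtain ⟨b, hb⟩ : ∃ b, b = f * q * e := ⟨_, rfl⟩
    have hab : a * b = e := by
      calc a * b = e * (p * (f * f) * q) * e := by rw [ha, hb]; simp only [mul_assoc]
        _ = e := by rw [hf, ← hpq, he, he]
    have hea : e * a = a := by rw [ha, ← mul_assoc, ← mul_assoc, he]
    have haf : a * f = a := by rw [ha, mul_assoc, hf]
    have hfb : f * b = b := by rw [hb, ← mul_assoc, ← mul_assoc, hf]
    refine ⟨a, b, hab, eq_of_idempotent_of_eq_mul_mul (x := r * a) (y := b * s) hf ?_ ?_ ?_ ?_⟩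
    · rw [mul_assoc, ← mul_assoc a, hab, hea]
    · rw [← mul_assoc, hfb]
    · rw [mul_assoc, haf]
    · calc f = r * (e * e) * s := by rw [he, hrs.symm]
        _ = r * a * (b * a) * (b * s) := by rw [← hab]; simp only [mul_assoc]
end

section
/- Let M be a finite monoid and A a filtered left M-set. Then A is cyclic, i.e., there exists c ∈ A such that every a ∈ A has the form a = m•c for some m ∈ M; in particular the cardinality of A is at most the cardinality of M. -/
/-- A left `M`-set `A` is filtered if it is nonempty (F1) and satisfies (F2) and (F3). -/
def Filtered (M A : Type*) [Monoid M] [MulAction M A] : Prop :=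
  Nonempty A ∧
    (∀ (m₁ m₂ : M) (a : A), m₁ • a = m₂ • a →
      ∃ (m : M) (b : A), m • b = a ∧ m₁ * m = m₂ * m) ∧
    (∀ a₁ a₂ : A, ∃ (m₁ m₂ : M) (a : A), m₁ • a = a₁ ∧ m₂ • a = a₂)

/-- Any filtered left `M`-set over a finite monoid `M` is cyclic; in particular
its cardinality is at most that of `M`. -/
theorem stmt_4 {M A : Type*} [Monoid M] [Finite M] [MulAction M A] (hA : Filtered M A) :
    (∃ c : A, ∀ a : A, ∃ m : M, a = m • c) ∧ Finite A ∧ Nat.card A ≤ Nat.card M := by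
  obtain ⟨⟨a₀⟩, -, hdir⟩ := hA
  have hfin (a : A) : (Set.range fun m : M => m • a).Finite := Set.finite_range _
  have hle (a : A) : (Set.range fun m : M => m • a).ncard ≤ Nat.card M := by
    rw [← Set.image_univ, ← Set.ncard_univ]
    exact Set.ncard_image_le Set.finite_univ
  -- A point whose orbit has maximal cardinality generates `A`.
  have hcyclic : ∃ c : A, ∀ a : A, ∃ m : M, a = m • c := by
    have hbdd : (Set.range fun a : A => (Set.range fun m : M => m • a).ncard).Finite :=
      (Set.finite_Iic (Nat.card M)).subset (by rintro _ ⟨a, rfl⟩; exact hle a)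
    obtain ⟨_, ⟨c, rfl⟩, hc⟩ := hbdd.exists_maximal ⟨_, a₀, rfl⟩
    refine ⟨c, fun a => ?_⟩
    obtain ⟨m₁, m₂, d, h₁, h₂⟩ := hdir c a
    have hsub : (Set.range fun m : M => m • c) ⊆ Set.range fun m : M => m • d := by
      rintro _ ⟨m, rfl⟩
      exact ⟨m * m₁, by simp only [mul_smul, h₁]⟩
    have heq := Set.eq_of_subset_of_ncard_le hsub
      (hc ⟨d, rfl⟩ (Set.ncard_le_ncard hsub (hfin d))) (hfin d)
    obtain ⟨m, hm⟩ : a ∈ Set.range fun m : M => m • c := heq ▸ ⟨m₂, h₂⟩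
    exact ⟨m, hm.symm⟩
  obtain ⟨c, hc⟩ := hcyclic
  have hsurj : Function.Surjective fun m : M => m • c := fun a => (hc a).imp fun _ h => h.symm
  exact ⟨⟨c, hc⟩, Finite.of_surjective _ hsurj, Nat.card_le_card_of_surjective _ hsurj⟩
end

section
/- Let K be an F-monoid. For any finite list of elements m₁, …, m_k of K there exists x ∈ K such that m_i*x = x for all 1 ≤ i ≤ k. -/
/-- In an `F`-monoid `K` (for all `m, n` there is `x` with `m*x = n*x`), for any finite
list of elements `m₁, …, m_k` there is an `x` with `m_i * x = x` for all `i`. -/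
theorem stmt_5 {K : Type*} [Monoid K] (hF : ∀ m n : K, ∃ x : K, m * x = n * x)
    (l : List K) : ∃ x : K, ∀ m ∈ l, m * x = x := by
  induction l with
  | nil => exact ⟨1, by simp⟩
  | cons a l ih =>
    obtain ⟨x, hx⟩ := ih
    obtain ⟨y, hy⟩ := hF (a * x) x
    refine ⟨x * y, fun m hm => ?_⟩
    rw [← mul_assoc]
    rcases List.mem_cons.mp hm with rfl | hm
    · exact hy
    · rw [hx m hm]
end

section
/- A finite monoid K is an F-monoid if and only if K has a right zero element, i.e., an element ϱ ∈ K such that x*ϱ = ϱ for all x ∈ K. -/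
/-- In an `F`-monoid, every finite set of elements fixes a common element by left
multiplication. -/
theorem exists_forall_mem_finset_mul_eq_self {K : Type*} [Monoid K]
    (h : ∀ m n : K, ∃ x : K, m * x = n * x) (s : Finset K) :
    ∃ r : K, ∀ x ∈ s, x * r = r := by
  classical
  induction s using Finset.induction_on with
  | empty => exact ⟨1, by simp⟩
  | insert a s _ ih =>
    obtain ⟨r, hr⟩ := ih
    obtain ⟨y, hy⟩ := h (a * r) r
    refine ⟨r * y, (Finset.forall_mem_insert a s _).2 ⟨?_, fun x hx => ?_⟩⟩
    · rw [← mul_assoc, hy]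
    · rw [← mul_assoc, hr x hx]

/-- A finite monoid is an `F`-monoid if and only if it has a right zero element. -/
theorem stmt_6 {K : Type*} [Monoid K] [Finite K] :
    (∀ m n : K, ∃ x : K, m * x = n * x) ↔ ∃ ϱ : K, ∀ x : K, x * ϱ = ϱ := by
  constructor
  · intro h
    cases nonempty_fintype K
    obtain ⟨r, hr⟩ := exists_forall_mem_finset_mul_eq_self h Finset.univ
    exact ⟨r, fun x => hr x (Finset.mem_univ x)⟩
  · rintro ⟨r, hr⟩ m n
    exact ⟨r, by rw [hr, hr]⟩
end

section
/- Let M be a monoid and K an F-submonoid of M. Then for all m, n ∈ M one has m ∼_K n (i.e., there exist x, y ∈ K with m*x = n*y) if and only if there exists x ∈ K with m*x = n*x; moreover the relation ∼_K is an equivalence relation on M and is an M-congruence on M viewed as a left M-set (m ∼_K n implies a*m ∼_K a*n for all a ∈ M). -/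
/-- The relation `∼_K` on `M` attached to a submonoid `K`:
`m ∼_K n` iff there are `x, y ∈ K` with `m*x = n*y`. -/
def relK {M : Type*} [Monoid M] (K : Submonoid M) (m n : M) : Prop :=
  ∃ x ∈ K, ∃ y ∈ K, m * x = n * y

/-- A submonoid `K` of `M` is an `F`-submonoid if for all `m, n ∈ K` there is
`x ∈ K` with `m*x = n*x`. -/
def IsFSubmonoid {M : Type*} [Monoid M] (K : Submonoid M) : Prop :=
  ∀ m ∈ K, ∀ n ∈ K, ∃ x ∈ K, m * x = n * x

/-- For an `F`-submonoid `K`, elements related by `∼_K` are equalized by an element of `K`. -/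
theorem relK_iff_exists_mul_eq {M : Type*} [Monoid M] {K : Submonoid M} (hF : IsFSubmonoid K)
    {m n : M} : relK K m n ↔ ∃ x ∈ K, m * x = n * x := by
  refine ⟨?_, fun ⟨x, hx, h⟩ => ⟨x, hx, x, hx, h⟩⟩
  rintro ⟨x, hx, y, hy, h⟩
  obtain ⟨z, hz, hxy⟩ := hF x hx y hy
  exact ⟨x * z, K.mul_mem hx hz, by rw [← mul_assoc, h, mul_assoc, hxy]⟩

theorem relK_equivalence {M : Type*} [Monoid M] {K : Submonoid M} (hF : IsFSubmonoid K) :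
    Equivalence (relK K) where
  refl _ := ⟨1, K.one_mem, 1, K.one_mem, rfl⟩
  symm := fun ⟨x, hx, y, hy, h⟩ => ⟨y, hy, x, hx, h.symm⟩
  trans := by
    rintro m n p ⟨x, hx, y, hy, hmn⟩ ⟨u, hu, v, hv, hnp⟩
    obtain ⟨z, hz, hyu⟩ := hF y hy u hu
    refine ⟨x * z, K.mul_mem hx hz, v * z, K.mul_mem hv hz, ?_⟩
    rw [← mul_assoc, hmn, mul_assoc, hyu, ← mul_assoc, hnp, mul_assoc]

theorem relK.mul_left {M : Type*} [Monoid M] {K : Submonoid M} {m n : M} (h : relK K m n)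
    (a : M) : relK K (a * m) (a * n) := by
  obtain ⟨x, hx, y, hy, h⟩ := h
  exact ⟨x, hx, y, hy, by rw [mul_assoc, h, mul_assoc]⟩

/-- For an `F`-submonoid `K` of `M`: `m ∼_K n` iff `m*x = n*x` for some `x ∈ K`;
moreover `∼_K` is an equivalence relation and an `M`-congruence on `M`. -/
theorem stmt_7 {M : Type*} [Monoid M] (K : Submonoid M) (hF : IsFSubmonoid K) :
    (∀ m n : M, relK K m n ↔ ∃ x ∈ K, m * x = n * x) ∧
    Equivalence (relK K) ∧
    (∀ a m n : M, relK K m n → relK K (a * m) (a * n)) := by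
  exact ⟨fun _ _ => relK_iff_exists_mul_eq hF, relK_equivalence hF, fun a _ _ h => h.mul_left a⟩
end

section
/- Let M be a monoid and K an F-submonoid of M. Then the quotient M/∼_K of M by the equivalence relation ∼_K, with the left M-action induced by left multiplication, is a filtered left M-set. -/
/-- The left `M`-action on the quotient `M/∼_K`, induced by left multiplication. -/
def qsmul {M : Type*} [Monoid M] (K : Submonoid M) (a : M) :
    Quot (relK K) → Quot (relK K) :=
  Quot.map (fun m => a * m) (fun m n h => by
    obtain ⟨x, hx, y, hy, hxy⟩ := h
    exact ⟨x, hx, y, hy, by rw [mul_assoc, hxy, ← mul_assoc]⟩)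

/-- Filteredness (F1)–(F3) of an `M`-set whose action is given by the function `smul`. -/
def FilteredSmul {M A : Type*} [Monoid M] (smul : M → A → A) : Prop :=
  Nonempty A ∧
    (∀ (m₁ m₂ : M) (a : A), smul m₁ a = smul m₂ a →
      ∃ (m : M) (b : A), smul m b = a ∧ m₁ * m = m₂ * m) ∧
    (∀ a₁ a₂ : A, ∃ (m₁ m₂ : M) (a : A), smul m₁ a = a₁ ∧ smul m₂ a = a₂)

/-- The relation `∼_K` of an `F`-submonoid is an equivalence relation. -/
theorem IsFSubmonoid.equivalence_relK {M : Type*} [Monoid M] {K : Submonoid M}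
    (hF : IsFSubmonoid K) : Equivalence (relK K) where
  refl m := ⟨1, K.one_mem, 1, K.one_mem, rfl⟩
  symm := fun ⟨x, hx, y, hy, h⟩ => ⟨y, hy, x, hx, h.symm⟩
  trans := by
    rintro m n p ⟨x, hx, y, hy, h⟩ ⟨z, hz, w, hw, h'⟩
    obtain ⟨t, ht, hyz⟩ := hF y hy z hz
    refine ⟨x * t, K.mul_mem hx ht, w * t, K.mul_mem hw ht, ?_⟩
    rw [← mul_assoc, h, mul_assoc, hyz, ← mul_assoc, h', mul_assoc]

/-- For an `F`-submonoid `K` of `M`, the quotient `M/∼_K` (with the action induced by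
left multiplication) is a filtered left `M`-set. -/
theorem stmt_8 {M : Type*} [Monoid M] (K : Submonoid M) (hF : IsFSubmonoid K) :
    FilteredSmul (qsmul K) := by
  refine ⟨⟨Quot.mk _ 1⟩, ?_, ?_⟩
  · rintro m₁ m₂ ⟨n⟩ h
    obtain ⟨x, hx, y, hy, hxy⟩ := (hF.equivalence_relK.quot_mk_eq_iff (m₁ * n) (m₂ * n)).mp h
    obtain ⟨t, ht, hxyt⟩ := hF x hx y hy
    refine ⟨n * (x * t), Quot.mk _ 1, Quot.sound ?_, ?_⟩
    · exact ⟨1, K.one_mem, x * t, K.mul_mem hx ht, by simp only [mul_one]⟩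
    · calc m₁ * (n * (x * t)) = m₁ * n * x * t := by simp only [mul_assoc]
        _ = m₂ * n * y * t := by rw [hxy]
        _ = m₂ * (n * (x * t)) := by rw [hxyt]; simp only [mul_assoc]
  · rintro ⟨n₁⟩ ⟨n₂⟩
    exact ⟨n₁, n₂, Quot.mk _ 1, congrArg (Quot.mk _) (mul_one n₁),
      congrArg (Quot.mk _) (mul_one n₂)⟩
end

section
/- Let M be a monoid and ρ an M-congruence on M (viewed as a left M-set) such that the quotient left M-set M/ρ is filtered. Then K_ρ = {m ∈ M | 1 ρ m} is a saturated F-submonoid of M. -/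
/-- The left `M`-action on the quotient `M/ρ` of an `M`-congruence `ρ`,
induced by left multiplication. -/
def rsmul {M : Type*} [Monoid M] (ρ : M → M → Prop)
    (hC : ∀ a m n : M, ρ m n → ρ (a * m) (a * n)) (a : M) : Quot ρ → Quot ρ :=
  Quot.map (fun m => a * m) (fun m n h => hC a m n h)

/-- If `ρ` is an `M`-congruence on `M` such that `M/ρ` is a filtered left `M`-set, then
`K_ρ = {m ∈ M | 1 ρ m}` is a saturated `F`-submonoid of `M`. -/
theorem stmt_9 {M : Type*} [Monoid M] (ρ : M → M → Prop) (hE : Equivalence ρ)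
    (hC : ∀ a m n : M, ρ m n → ρ (a * m) (a * n))
    (hfil : FilteredSmul (rsmul ρ hC)) :
    ∃ K : Submonoid M, (K : Set M) = {m : M | ρ 1 m} ∧
      (∀ m ∈ K, ∀ n ∈ K, ∃ x ∈ K, m * x = n * x) ∧
      (∀ m x : M, x ∈ K → m * x = x → m ∈ K) := by
  obtain ⟨-, hF2, -⟩ := hfil
  refine ⟨{ carrier := {m | ρ 1 m}, one_mem' := hE.refl 1, mul_mem' := ?_ }, rfl, ?_, ?_⟩
  · intro a b (ha : ρ 1 a) (hb : ρ 1 b)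
    have hab := hC a 1 b hb
    rw [mul_one] at hab
    exact hE.trans ha hab
  · intro m (hm : ρ 1 m) n (hn : ρ 1 n)
    have hmn : rsmul ρ hC m (Quot.mk ρ 1) = rsmul ρ hC n (Quot.mk ρ 1) := by
      refine Quot.sound ?_
      simpa only [mul_one] using hE.trans (hE.symm hm) hn
    obtain ⟨p, b, hpb, hp⟩ := hF2 m n _ hmn
    induction b using Quot.ind with
    | mk c =>
      refine ⟨p * c, ?_, by rw [← mul_assoc, hp, mul_assoc]⟩
      have hpc : ρ (p * c) 1 := hE.eqvGen_iff.mp (Quot.eqvGen_exact hpb)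
      exact hE.symm hpc
  · intro m x (hx : ρ 1 x) hmx
    have hm := hC m 1 x hx
    rw [mul_one, hmx] at hm
    exact hE.trans hx (hE.symm hm)
end

section
/- Let M be a monoid and ρ an M-congruence on M (viewed as a left M-set) such that the quotient left M-set M/ρ is filtered, and set K_ρ = {m ∈ M | 1 ρ m}. Then for all m, n ∈ M one has m ρ n if and only if there exists x ∈ K_ρ with m*x = n*x. -/
/-- If `ρ` is an `M`-congruence on `M` such that `M/ρ` is a filtered left `M`-set, then
with `K_ρ = {m ∈ M | 1 ρ m}` one has: `m ρ n` iff `m*x = n*x` for some `x ∈ K_ρ`. -/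
theorem stmt_10 {M : Type*} [Monoid M] (ρ : M → M → Prop) (hE : Equivalence ρ)
    (hC : ∀ a m n : M, ρ m n → ρ (a * m) (a * n))
    (hfil : FilteredSmul (rsmul ρ hC)) :
    ∀ m n : M, ρ m n ↔ ∃ x : M, ρ 1 x ∧ m * x = n * x := by
  intro m n
  constructor
  · intro h
    obtain ⟨p, b, hb, hp⟩ := hfil.2.1 m n (Quot.mk ρ 1)
      (Quot.sound (by simpa only [mul_one] using h))
    induction b using Quot.ind with
    | mk c =>
      have hpc : ρ (p * c) 1 := hE.eqvGen_iff.mp (Quot.eqvGen_exact hb)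
      exact ⟨p * c, hE.symm hpc, by rw [← mul_assoc, hp, mul_assoc]⟩
  · rintro ⟨x, hx, hmn⟩
    have hm := hC m 1 x hx
    have hn := hC n 1 x hx
    rw [mul_one] at hm hn
    exact hE.trans hm (hmn ▸ hE.symm hn)
end

section
/- Let M be a monoid and K an F-submonoid of M. Then the set L = {m ∈ M | there exists x ∈ K with m*x = x} is the smallest saturated submonoid of M containing K (i.e., L is a saturated submonoid, K ⊆ L, and L is contained in every saturated submonoid of M containing K), and L is itself an F-submonoid of M. -/
/-- A submonoid `K` of `M` is saturated if `m*x = x` with `x ∈ K` implies `m ∈ K`. -/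
def Saturated {M : Type*} [Monoid M] (K : Submonoid M) : Prop :=
  ∀ m x : M, x ∈ K → m * x = x → m ∈ K

/-- Two elements fixing elements of an `F`-submonoid fix a common element of it. -/
theorem IsFSubmonoid.exists_common_fixed {M : Type*} [Monoid M] {K : Submonoid M}
    (hF : IsFSubmonoid K) {m n x y : M} (hx : x ∈ K) (hy : y ∈ K)
    (hm : m * x = x) (hn : n * y = y) : ∃ w ∈ K, m * w = w ∧ n * w = w := by
  obtain ⟨z, hz, h⟩ := hF x hx y hy
  refine ⟨x * z, K.mul_mem hx hz, by rw [← mul_assoc, hm], ?_⟩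
  rw [h, ← mul_assoc, hn]

/-- For an `F`-submonoid `K` of `M`, the set `L = {m | ∃ x ∈ K, m*x = x}` is the smallest
saturated submonoid of `M` containing `K`, and `L` is itself an `F`-submonoid. -/
theorem stmt_11 {M : Type*} [Monoid M] (K : Submonoid M) (hF : IsFSubmonoid K) :
    ∃ L : Submonoid M, (L : Set M) = {m : M | ∃ x ∈ K, m * x = x} ∧
      Saturated L ∧ K ≤ L ∧
      (∀ T : Submonoid M, Saturated T → K ≤ T → L ≤ T) ∧
      IsFSubmonoid L := by
  have hK : ∀ m ∈ K, ∃ x ∈ K, m * x = x := fun m hm => by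
    simpa using hF m hm 1 K.one_mem
  refine ⟨{ carrier := {m : M | ∃ x ∈ K, m * x = x}
            one_mem' := ⟨1, K.one_mem, one_mul 1⟩
            mul_mem' := ?_ }, rfl, ?_, hK, ?_, ?_⟩
  · rintro m n ⟨x, hx, hm⟩ ⟨y, hy, hn⟩
    obtain ⟨w, hw, hmw, hnw⟩ := hF.exists_common_fixed hx hy hm hn
    exact ⟨w, hw, by rw [mul_assoc, hnw, hmw]⟩
  · rintro m l ⟨x, hx, hl⟩ hm
    exact ⟨x, hx, by rw [← hl, ← mul_assoc, hm]⟩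
  · rintro T hT hKT m ⟨x, hx, hm⟩
    exact hT m x (hKT hx) hm
  · rintro m ⟨x, hx, hm⟩ n ⟨y, hy, hn⟩
    obtain ⟨w, hw, hmw, hnw⟩ := hF.exists_common_fixed hx hy hm hn
    exact ⟨w, hK w hw, hmw.trans hnw.symm⟩
end

section
/- Let M be a finite monoid. Every filtered left M-set A is isomorphic, as a left M-set, to the quotient M/∼_K for some saturated F-submonoid K of M. -/
/-- A filtered set over a finite monoid is cyclic. -/
theorem Filtered.exists_generator {M A : Type*} [Monoid M] [Finite M] [MulAction M A]
    (hA : Filtered M A) : ∃ a : A, ∀ b : A, ∃ m : M, m • a = b := by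
  obtain ⟨⟨a₀⟩, -, h3⟩ := hA
  have hfin (a : A) : (MulAction.orbit M a).Finite := Set.finite_range _
  have hbound (a : A) : (MulAction.orbit M a).ncard ≤ Nat.card M := by
    rw [← Nat.card_coe_set_eq]
    exact Nat.card_le_card_of_surjective _ Set.rangeFactorization_surjective
  have : Nonempty A := ⟨a₀⟩
  obtain ⟨a, ha⟩ : ∃ a : A, ∀ b : A,
      (MulAction.orbit M b).ncard ≤ (MulAction.orbit M a).ncard := by
    obtain ⟨_, ⟨a, rfl⟩, ha⟩ := Set.exists_max_image
      (Set.range fun a : A => (MulAction.orbit M a).ncard) id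
      ((Set.finite_Iic (Nat.card M)).subset (Set.range_subset_iff.2 hbound))
      (Set.range_nonempty _)
    exact ⟨a, fun b => ha _ ⟨b, rfl⟩⟩
  refine ⟨a, fun b => ?_⟩
  obtain ⟨p, q, c, rfl, rfl⟩ := h3 a b
  have hsub : MulAction.orbit M (p • c) ⊆ MulAction.orbit M c := by
    rintro _ ⟨m, rfl⟩
    exact ⟨m * p, mul_smul m p c⟩
  have hmem : q • c ∈ MulAction.orbit M (p • c) := by
    rw [Set.eq_of_subset_of_ncard_le hsub (ha c) (hfin c)]
    exact ⟨q, rfl⟩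
  exact hmem

/-- In a filtered set generated by `a`, elements of `M` that agree on `a` are equalized by an
element of the stabilizer of `a`. -/
theorem Filtered.exists_mem_stabilizer_mul_eq {M A : Type*} [Monoid M] [MulAction M A]
    (hA : Filtered M A) {a : A} (ha : ∀ b : A, ∃ m : M, m • a = b) {m n : M}
    (h : m • a = n • a) : ∃ x ∈ MulAction.stabilizerSubmonoid M a, m * x = n * x := by
  obtain ⟨p, b, hb, hp⟩ := hA.2.1 m n a h
  obtain ⟨q, rfl⟩ := ha b
  exact ⟨p * q, by rwa [MulAction.mem_stabilizerSubmonoid_iff, mul_smul],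
    by rw [← mul_assoc, hp, mul_assoc]⟩

/-- Every filtered left `M`-set over a finite monoid `M` is isomorphic, as a left `M`-set,
to `M/∼_K` for some saturated `F`-submonoid `K` of `M`. -/
theorem stmt_12 {M A : Type*} [Monoid M] [Finite M] [MulAction M A] (hA : Filtered M A) :
    ∃ K : Submonoid M, IsFSubmonoid K ∧ Saturated K ∧
      ∃ f : A ≃ Quot (relK K), ∀ (m : M) (a : A), f (m • a) = qsmul K m (f a) := by
  obtain ⟨a, ha⟩ := hA.exists_generator
  have stab {x : M} (hx : x ∈ MulAction.stabilizerSubmonoid M a) : x • a = a := hx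
  have smul_eq {m n : M} (h : relK (MulAction.stabilizerSubmonoid M a) m n) :
      m • a = n • a := by
    obtain ⟨x, hx, y, hy, hxy⟩ := h
    rw [← stab hx, ← mul_smul, hxy, mul_smul, stab hy, stab hx]
  let g : Quot (relK (MulAction.stabilizerSubmonoid M a)) → A :=
    Quot.lift (fun m => m • a) fun _ _ => smul_eq
  have hg : Function.Bijective g := by
    constructor
    · rintro ⟨m⟩ ⟨n⟩ h
      obtain ⟨x, hx, hmn⟩ := hA.exists_mem_stabilizer_mul_eq ha h
      exact Quot.sound ⟨x, hx, x, hx, hmn⟩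
    · intro b
      obtain ⟨m, hm⟩ := ha b
      exact ⟨Quot.mk _ m, hm⟩
  refine ⟨MulAction.stabilizerSubmonoid M a, ?_, ?_, (Equiv.ofBijective g hg).symm, ?_⟩
  · intro m hm n hn
    exact hA.exists_mem_stabilizer_mul_eq ha ((stab hm).trans (stab hn).symm)
  · intro m x hx h
    rw [MulAction.mem_stabilizerSubmonoid_iff]
    nth_rewrite 1 [← stab hx]
    rw [← mul_smul, h, stab hx]
  · intro m b
    obtain ⟨⟨n⟩, rfl⟩ := (Equiv.ofBijective g hg).surjective b
    rw [Equiv.symm_apply_apply, Equiv.symm_apply_eq]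
    exact (mul_smul m n a).symm
end

section
/- Let M be a finite monoid. Every filtered left M-set is isomorphic, as a left M-set, to Me = {m*e | m ∈ M} for some idempotent e ∈ M, where Me carries the left M-action given by left multiplication. -/
namespace Filtered

variable {M A : Type*} [Monoid M] [Finite M] [MulAction M A]

/-- A filtered set over a finite monoid is cyclic: a generator is an element with an orbit of
maximal size. -/
theorem exists_generator_s14 (hA : Filtered M A) : ∃ a : A, ∀ x : A, ∃ m : M, m • a = x := by
  obtain ⟨⟨a₀⟩, -, h3⟩ := hA
  have hfin (a : A) : (MulAction.orbit M a).Finite := Set.finite_range _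
  have hbdd : BddAbove (Set.range fun a : A => (MulAction.orbit M a).ncard) := by
    refine ⟨Nat.card M, ?_⟩
    rintro _ ⟨a, rfl⟩
    exact Finite.card_range_le fun m : M => m • a
  obtain ⟨a, ha⟩ := Nat.sSup_mem (Set.range_nonempty_iff_nonempty.2 ⟨a₀⟩) hbdd
  refine ⟨a, fun x => ?_⟩
  obtain ⟨m₁, m₂, b, rfl, rfl⟩ := h3 a x
  have hsub : MulAction.orbit M (m₁ • b) ⊆ MulAction.orbit M b := by
    rintro _ ⟨m, rfl⟩
    exact ⟨m * m₁, mul_smul m m₁ b⟩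
  have hcard : (MulAction.orbit M b).ncard ≤ (MulAction.orbit M (m₁ • b)).ncard :=
    (le_csSup hbdd ⟨b, rfl⟩).trans ha.ge
  have heq := Set.eq_of_subset_of_ncard_le hsub hcard (hfin b)
  have hmem : m₂ • b ∈ MulAction.orbit M (m₁ • b) := heq ▸ ⟨m₂, rfl⟩
  exact hmem

/-- Some element fixing a generator `a` coequalizes all pairs that agree on `a`. -/
theorem exists_fixing_coequalizer (hA : Filtered M A) {a : A}
    (ha : ∀ x : A, ∃ m : M, m • a = x) :
    ∃ e : M, e • a = a ∧ ∀ m₁ m₂ : M, m₁ • a = m₂ • a → m₁ * e = m₂ * e := by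
  have key (s : Set (M × M)) :
      ∃ e : M, e • a = a ∧ ∀ p ∈ s, p.1 • a = p.2 • a → p.1 * e = p.2 * e := by
    induction s, s.toFinite using Set.Finite.induction_on with
    | empty => exact ⟨1, one_smul M a, by simp⟩
    | @insert p s _ _ ih =>
      obtain ⟨e, hea, he⟩ := ih
      by_cases hp : p.1 • a = p.2 • a
      · obtain ⟨m, b, hmb, hm⟩ := hA.2.1 (p.1 * e) (p.2 * e) a (by simpa [mul_smul, hea] using hp)
        obtain ⟨k, rfl⟩ := ha b
        refine ⟨e * (m * k), by rw [mul_smul, mul_smul, hmb, hea], ?_⟩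
        rintro q (rfl | hq) hqa
        · simp only [← mul_assoc, hm]
        · simp only [← mul_assoc, he q hq hqa]
      · refine ⟨e, hea, ?_⟩
        rintro q (rfl | hq) hqa
        · exact absurd hqa hp
        · exact he q hq hqa
  obtain ⟨e, hea, he⟩ := key Set.univ
  exact ⟨e, hea, fun m₁ m₂ h => he (m₁, m₂) trivial h⟩

end Filtered

/-- Every filtered left `M`-set over a finite monoid `M` is isomorphic, as a left `M`-set,
to `Me = {m*e | m ∈ M}` for some idempotent `e ∈ M`, where `Me` carries the left
`M`-action by left multiplication. -/
theorem stmt_14 {M A : Type*} [Monoid M] [Finite M] [MulAction M A] (hA : Filtered M A) :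
    ∃ e : M, e * e = e ∧
      ∃ f : A ≃ {a : M // ∃ m : M, a = m * e},
        ∀ (m : M) (x : A), (f (m • x)).1 = m * (f x).1 := by
  obtain ⟨a, ha⟩ := hA.exists_generator_s14
  obtain ⟨e, hea, he⟩ := hA.exists_fixing_coequalizer ha
  have hee : e * e = e := by simpa using he e 1 (by rw [hea, one_smul])
  let g : {x : M // ∃ m : M, x = m * e} → A := fun x => x.1 • a
  have hg : Function.Bijective g := by
    refine ⟨?_, fun x => ?_⟩
    · rintro ⟨_, m₁, rfl⟩ ⟨_, m₂, rfl⟩ h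
      have h' := he _ _ h
      simp only [mul_assoc, hee] at h'
      exact Subtype.ext h'
    · obtain ⟨m, rfl⟩ := ha x
      exact ⟨⟨m * e, m, rfl⟩, by simp only [g, mul_smul, hea]⟩
  refine ⟨e, hee, (Equiv.ofBijective g hg).symm, fun m x => ?_⟩
  obtain ⟨y, rfl⟩ := (Equiv.ofBijective g hg).surjective x
  obtain ⟨_, k, rfl⟩ := y
  have hsmul : m • Equiv.ofBijective g hg ⟨k * e, k, rfl⟩ =
      Equiv.ofBijective g hg ⟨m * (k * e), m * k, (mul_assoc m k e).symm⟩ :=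
    (mul_smul m (k * e) a).symm
  rw [hsmul, Equiv.symm_apply_apply, Equiv.symm_apply_apply]
end

section
/- Let M be a monoid and 𝔪 a two-sided ideal of M such that 𝔪·𝔪 = 𝔪, where 𝔪·𝔪 = {x*y | x, y ∈ 𝔪}. Then the collection F_𝔪 of all right ideals of M containing 𝔪 is a Grothendieck topology on M: (T1) M ∈ F_𝔪; (T2) if 𝔞 ∈ F_𝔪 and m ∈ M then (𝔞 : m) = {x ∈ M | m*x ∈ 𝔞} belongs to F_𝔪; (T3) if 𝔟 ∈ F_𝔪 and 𝔞 is a right ideal of M such that (𝔞 : b) ∈ F_𝔪 for every b ∈ 𝔟, then 𝔞 ∈ F_𝔪. -/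
/-- A right ideal of a monoid `M`. -/
def IsRightIdeal {M : Type*} [Monoid M] (S : Set M) : Prop :=
  ∀ a ∈ S, ∀ m : M, a * m ∈ S

/-- A two-sided ideal of a monoid `M`. -/
def IsTwoSidedIdeal {M : Type*} [Monoid M] (S : Set M) : Prop :=
  ∀ a ∈ S, ∀ m : M, a * m ∈ S ∧ m * a ∈ S

/-- A Grothendieck topology on a monoid `M`: a collection of right ideals satisfying
(T1), (T2) and (T3). Here `(𝔞 : m) = {x | m*x ∈ 𝔞}`. -/
def IsGrothendieckTopology {M : Type*} [Monoid M] (F : Set (Set M)) : Prop :=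
  (∀ S ∈ F, IsRightIdeal S) ∧
  (Set.univ ∈ F) ∧
  (∀ a ∈ F, ∀ m : M, {x : M | m * x ∈ a} ∈ F) ∧
  (∀ b ∈ F, ∀ a : Set M, IsRightIdeal a →
    (∀ x ∈ b, {y : M | x * y ∈ a} ∈ F) → a ∈ F)

/-- If `𝔪` is a two-sided ideal of `M` with `𝔪·𝔪 = 𝔪`, then the collection of all right
ideals of `M` containing `𝔪` is a Grothendieck topology on `M`. -/
theorem stmt_15 {M : Type*} [Monoid M] (I : Set M) (hI : IsTwoSidedIdeal I)
    (hI2 : {z : M | ∃ x ∈ I, ∃ y ∈ I, z = x * y} = I) :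
    IsGrothendieckTopology {S : Set M | IsRightIdeal S ∧ I ⊆ S} := by
  refine ⟨fun S hS => hS.1, ⟨fun _ _ _ => trivial, Set.subset_univ I⟩, ?_, ?_⟩
  · rintro a ⟨ha, hIa⟩ m
    refine ⟨fun x hx n => ?_, fun x hx => hIa (hI x hx m).2⟩
    simpa only [Set.mem_ofPred_eq, mul_assoc] using ha (m * x) hx n
  · rintro b ⟨-, hIb⟩ a ha h
    refine ⟨ha, fun z hz => ?_⟩
    rw [← hI2] at hz
    obtain ⟨x, hx, y, hy, rfl⟩ := hz
    exact (h x (hIb hx)).2 hy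
end

section
/- Let M be a finite monoid and F a Grothendieck topology on M. Then there exists a two-sided ideal 𝔪 of M with 𝔪·𝔪 = 𝔪 such that F is exactly the collection of right ideals of M containing 𝔪. -/
namespace IsGrothendieckTopology

variable {M : Type*} [Monoid M] {F : Set (Set M)}

theorem mem_of_superset (hF : IsGrothendieckTopology F) {S T : Set M} (hS : S ∈ F)
    (hT : IsRightIdeal T) (hST : S ⊆ T) : T ∈ F := by
  obtain ⟨-, h1, -, h3⟩ := hF
  refine h3 S hS T hT fun x hx => ?_
  have : {y : M | x * y ∈ T} = Set.univ := Set.eq_univ_of_forall fun y => hT x (hST hx) y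
  rwa [this]

theorem inter_mem (hF : IsGrothendieckTopology F) {S T : Set M} (hS : S ∈ F) (hT : T ∈ F) :
    S ∩ T ∈ F := by
  obtain ⟨h0, -, h2, h3⟩ := hF
  refine h3 S hS _ (fun a ha m => ⟨h0 S hS a ha.1 m, h0 T hT a ha.2 m⟩) fun x hx => ?_
  have : {y : M | x * y ∈ S ∩ T} = {y : M | x * y ∈ T} :=
    Set.ext fun y => ⟨fun h => h.2, fun h => ⟨h0 S hS x hx y, h⟩⟩
  rw [this]
  exact h2 T hT x

theorem exists_isLeast [Finite M] (hF : IsGrothendieckTopology F) : ∃ I, IsLeast F I := by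
  obtain ⟨I, hI, hmin⟩ := F.toFinite.exists_minimal ⟨_, hF.2.1⟩
  exact ⟨I, hI, fun S hS =>
    (hmin (hF.inter_mem hI hS) Set.inter_subset_left).trans Set.inter_subset_right⟩

end IsGrothendieckTopology

/-- For any Grothendieck topology `F` on a finite monoid `M`, there is a two-sided ideal
`𝔪` with `𝔪·𝔪 = 𝔪` such that `F` is exactly the collection of right ideals containing `𝔪`. -/
theorem stmt_16 {M : Type*} [Monoid M] [Finite M] (F : Set (Set M))
    (hF : IsGrothendieckTopology F) :
    ∃ I : Set M, IsTwoSidedIdeal I ∧ {z : M | ∃ x ∈ I, ∃ y ∈ I, z = x * y} = I ∧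
      F = {S : Set M | IsRightIdeal S ∧ I ⊆ S} := by
  obtain ⟨I, hI, hle⟩ := hF.exists_isLeast
  have hr := hF.1 I hI
  refine ⟨I, fun a ha m => ⟨hr a ha m, hle (hF.2.2.1 I hI m) ha⟩, ?_, ?_⟩
  · apply Set.Subset.antisymm
    · rintro z ⟨x, hx, y, -, rfl⟩
      exact hr x hx y
    · have hprod : IsRightIdeal {z : M | ∃ x ∈ I, ∃ y ∈ I, z = x * y} := by
        rintro z ⟨x, hx, y, hy, rfl⟩ m
        exact ⟨x, hx, y * m, hr y hy m, mul_assoc x y m⟩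
      refine hle (hF.2.2.2 I hI _ hprod fun x hx => hF.mem_of_superset hI ?_ ?_)
      · intro a ha m
        simpa only [Set.mem_ofPred_eq, mul_assoc] using hprod (x * a) ha m
      · exact fun y hy => ⟨x, hx, y, hy, rfl⟩
  · ext S
    exact ⟨fun hS => ⟨hF.1 S hS, hle hS⟩, fun h => hF.mem_of_superset hI h.1 h.2⟩
end

section
/- Let M be a finite commutative monoid. If I and J are two-sided idempotent ideals of M, then I ∩ J is a two-sided idempotent ideal of M. -/
/-- The elementwise product `I·J = {x*y | x ∈ I, y ∈ J}` of two subsets of `M`. -/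
def setMul {M : Type*} [Monoid M] (I J : Set M) : Set M :=
  {z : M | ∃ x ∈ I, ∃ y ∈ J, z = x * y}

/-- Every element of an idempotent ideal of a finite commutative monoid is fixed by multiplication
by some element of the ideal. -/
theorem IsTwoSidedIdeal.exists_mem_mul_eq_self {M : Type*} [CommMonoid M] [Finite M] {I : Set M}
    (hI : IsTwoSidedIdeal I) (hI2 : setMul I I = I) {x : M} (hx : x ∈ I) :
    ∃ s ∈ I, s * x = x := by
  let r : M → M → Prop := fun a b => a ∣ b ∧ ¬ b ∣ a
  have : IsTrans M r := ⟨fun _ _ _ h₁ h₂ => ⟨h₁.1.trans h₂.1, fun h => h₁.2 (h₂.1.trans h)⟩⟩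
  have : Std.Irrefl r := ⟨fun _ h => h.2 h.1⟩
  have hwf : WellFounded r := Finite.wellFounded_of_trans_of_irrefl r
  obtain ⟨d, ⟨hd, t, rfl⟩, hmin⟩ := hwf.has_min {d | d ∈ I ∧ d ∣ x} ⟨x, hx, dvd_rfl⟩
  obtain ⟨a, ha, b, hb, hab⟩ : d ∈ setMul I I := hI2.symm ▸ hd
  have had : a ∣ d := ⟨b, hab⟩
  obtain ⟨c, hc⟩ : d ∣ a := by
    by_contra h
    exact hmin a ⟨ha, had.mul_right t⟩ ⟨had, h⟩
  refine ⟨c * b, (hI b hb c).2, ?_⟩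
  have h : c * b * d = d := by
    rw [mul_comm, ← mul_assoc, ← hc, ← hab]
  rw [← mul_assoc, h]

/-- In a finite commutative monoid, the intersection of two two-sided idempotent ideals is
a two-sided idempotent ideal. -/
theorem stmt_18 {M : Type*} [CommMonoid M] [Finite M]
    (I J : Set M) (hI : IsTwoSidedIdeal I) (hI2 : setMul I I = I)
    (hJ : IsTwoSidedIdeal J) (hJ2 : setMul J J = J) :
    IsTwoSidedIdeal (I ∩ J) ∧ setMul (I ∩ J) (I ∩ J) = I ∩ J := by
  have hIJ : IsTwoSidedIdeal (I ∩ J) := fun a ha m =>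
    ⟨⟨(hI a ha.1 m).1, (hJ a ha.2 m).1⟩, ⟨(hI a ha.1 m).2, (hJ a ha.2 m).2⟩⟩
  refine ⟨hIJ, Set.Subset.antisymm ?_ fun x hx => ?_⟩
  · rintro _ ⟨x, hx, y, -, rfl⟩
    exact (hIJ x hx y).1
  · obtain ⟨s, hs, hsx⟩ := hI.exists_mem_mul_eq_self hI2 hx.1
    obtain ⟨t, ht, htx⟩ := hJ.exists_mem_mul_eq_self hJ2 hx.2
    exact ⟨s * t, ⟨(hI s hs t).1, (hJ t ht s).2⟩, x, hx, by rw [mul_assoc, htx, hsx]⟩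
end

section
/- Let M be a finite monoid and let I and J be two-sided idempotent ideals of M. Define W to be the union, over all idempotents e ∈ I ∩ J, of the sets MeM = {m*e*n | m, n ∈ M}. Then W is a two-sided idempotent ideal of M contained in both I and J, and every two-sided idempotent ideal of M contained in both I and J is contained in W (i.e., W is the greatest two-sided idempotent ideal contained in I ∩ J). -/
/-- The union of the sets `MeM = {m*e*n | m, n ∈ M}` over all idempotents `e ∈ I ∩ J`. -/
def unionMeM {M : Type*} [Monoid M] (I J : Set M) : Set M :=
  {z : M | ∃ e : M, e ∈ I ∧ e ∈ J ∧ e * e = e ∧ ∃ m n : M, z = m * e * n}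

/-- In a finite semigroup, every nonempty subset closed under multiplication contains an
idempotent. -/
theorem exists_mul_self_eq_of_finite {S : Type*} [Semigroup S] [Finite S] (T : Set S)
    (hne : T.Nonempty) (hmul : ∀ a ∈ T, ∀ b ∈ T, a * b ∈ T) : ∃ e ∈ T, e * e = e := by
  let _ : TopologicalSpace S := ⊥
  have : DiscreteTopology S := ⟨rfl⟩
  exact exists_idempotent_in_compact_subsemigroup (fun _ => continuous_of_discreteTopology) T hne
    T.toFinite.isCompact hmul

/-- Every element of an idempotent two-sided ideal `K` of a finite monoid lies in `MeM` for some
idempotent `e ∈ K`. -/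
theorem exists_idempotent_factorization {M : Type*} [Monoid M] [Finite M] {K : Set M}
    (hK : IsTwoSidedIdeal K) (hK2 : setMul K K = K) {x : M} (hx : x ∈ K) :
    ∃ e ∈ K, e * e = e ∧ ∃ m n : M, x = m * e * n := by
  have hfac : ∀ y : K, ∃ a z : K, (y : M) = a * z := by
    rintro ⟨y, hy⟩
    rw [← hK2] at hy
    obtain ⟨a, ha, z, hz, h⟩ := hy
    exact ⟨⟨a, ha⟩, ⟨z, hz⟩, h⟩
  choose a g hag using hfac
  let y : ℕ → K := fun n => g^[n] ⟨x, hx⟩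
  have hy (n : ℕ) : (y n : M) = a (y n) * y (n + 1) := by
    simpa only [y, Function.iterate_succ_apply'] using hag (y n)
  have hstep (i d : ℕ) : ∃ q ∈ K, (y i : M) = q * y (i + d + 1) := by
    induction d with
    | zero => exact ⟨a (y i), (a (y i)).2, hy i⟩
    | succ d ih =>
      obtain ⟨q, hq, h⟩ := ih
      exact ⟨q * a (y (i + d + 1)), (hK q hq _).1, by rw [h, hy (i + d + 1), mul_assoc]; rfl⟩
  have hprefix (n : ℕ) : ∃ p : M, x = p * y n := by
    cases n with
    | zero => exact ⟨1, (one_mul x).symm⟩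
    | succ n =>
      obtain ⟨q, -, h⟩ := hstep 0 n
      exact ⟨q, by simpa [y] using h⟩
  have hrepeat : ∃ i j, i < j ∧ y i = y j := by
    obtain ⟨i, j, hij, h⟩ := Finite.exists_ne_map_eq_of_infinite y
    rcases hij.lt_or_gt with hlt | hlt
    · exact ⟨i, j, hlt, h⟩
    · exact ⟨j, i, hlt, h.symm⟩
  obtain ⟨i, j, hij, h⟩ := hrepeat
  obtain ⟨d, rfl⟩ := Nat.exists_eq_add_of_lt hij
  obtain ⟨q, hq, hqy⟩ := hstep i d
  rw [← h] at hqy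
  obtain ⟨e, ⟨heK, hey⟩, he⟩ := exists_mul_self_eq_of_finite {e : M | e ∈ K ∧ e * y i = y i}
    ⟨q, hq, hqy.symm⟩
    fun b hb c hc => ⟨(hK b hb.1 c).1, by rw [mul_assoc, hc.2, hb.2]⟩
  obtain ⟨p, hp⟩ := hprefix i
  exact ⟨e, heK, he, p, y i, by rw [mul_assoc, hey, hp]⟩

/-- For two-sided idempotent ideals `I, J` of a finite monoid `M`, the union `W` of the
sets `MeM` over all idempotents `e ∈ I ∩ J` is the greatest two-sided idempotent ideal of
`M` contained in both `I` and `J`. -/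
theorem stmt_19 {M : Type*} [Monoid M] [Finite M] (I J : Set M)
    (hI : IsTwoSidedIdeal I) (hI2 : setMul I I = I)
    (hJ : IsTwoSidedIdeal J) (hJ2 : setMul J J = J) :
    IsTwoSidedIdeal (unionMeM I J) ∧ setMul (unionMeM I J) (unionMeM I J) = unionMeM I J ∧
      unionMeM I J ⊆ I ∧ unionMeM I J ⊆ J ∧
      ∀ K : Set M, IsTwoSidedIdeal K → setMul K K = K → K ⊆ I → K ⊆ J →
        K ⊆ unionMeM I J := by
  have hideal : IsTwoSidedIdeal (unionMeM I J) := by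
    rintro _ ⟨e, heI, heJ, he, m, n, rfl⟩ k
    exact ⟨⟨e, heI, heJ, he, m, n * k, by simp only [mul_assoc]⟩,
      ⟨e, heI, heJ, he, k * m, n, by simp only [mul_assoc]⟩⟩
  refine ⟨hideal, ?_, ?_, ?_, ?_⟩
  · apply Set.Subset.antisymm
    · rintro _ ⟨a, ha, b, -, rfl⟩
      exact (hideal a ha b).1
    · rintro _ ⟨e, heI, heJ, he, m, n, rfl⟩
      refine ⟨m * e, ⟨e, heI, heJ, he, m, 1, (mul_one _).symm⟩,
        e * n, ⟨e, heI, heJ, he, 1, n, by rw [one_mul]⟩, ?_⟩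
      rw [mul_assoc m e (e * n), ← mul_assoc e e n, he, mul_assoc]
  · rintro _ ⟨e, heI, -, -, m, n, rfl⟩
    exact (hI _ (hI e heI m).2 n).1
  · rintro _ ⟨e, -, heJ, -, m, n, rfl⟩
    exact (hJ _ (hJ e heJ m).2 n).1
  · intro K hK hK2 hKI hKJ x hx
    obtain ⟨e, heK, he, hmn⟩ := exists_idempotent_factorization hK hK2 hx
    exact ⟨e, hKI heK, hKJ heK, he, hmn⟩
end
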